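/- Let S be a nonzero ℂ-linear subspace of the m×n complex matrices. If mrk(S) = dim Im(S), or if mrk(S) = n − dim Ker(S), then mrk(S ⊗ S) = mrk(S)². -/

import Mathlib

open Matrix

noncomputable def mrk {m n : Type*} [Fintype m] [Fintype n]
    (S : Submodule ℂ (Matrix m n ℂ)) : ℕ :=
  sSup (Matrix.rank '' (S : Set (Matrix m n ℂ)))

noncomputable def tensorSpace {m₁ n₁ m₂ n₂ : Type*}
    (S : Submodule ℂ (Matrix m₁ n₁ ℂ)) (T : Submodule ℂ (Matrix m₂ n₂ ℂ)) :
    Submodule ℂ (Matrix (m₁ × m₂) (n₁ × n₂) ℂ) :=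
  Submodule.span ℂ {M | ∃ A ∈ S, ∃ B ∈ T, M = Matrix.kroneckerMap (· * ·) A B}

noncomputable def tensorPow {d : ℕ} (S : Submodule ℂ (Matrix (Fin d) (Fin d) ℂ)) (n : ℕ) :
    Submodule ℂ (Matrix (Fin n → Fin d) (Fin n → Fin d) ℂ) :=
  Submodule.span ℂ {M | ∃ A : Fin n → Matrix (Fin d) (Fin d) ℂ,
    (∀ k, A k ∈ S) ∧ M = fun i j => ∏ k, A k (i k) (j k)}

noncomputable def spaceImageOf {ι κ : Type*} [Fintype κ]
    (S : Submodule ℂ (Matrix ι κ ℂ)) (U : Submodule ℂ (κ → ℂ)) : Submodule ℂ (ι → ℂ) :=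
  Submodule.span ℂ {v | ∃ A ∈ S, ∃ u ∈ U, v = A.mulVec u}

def HasShrunkSubspace {ι : Type*} [Fintype ι]
    (S : Submodule ℂ (Matrix ι ι ℂ)) : Prop :=
  ∃ U : Submodule ℂ (ι → ℂ),
    Module.finrank ℂ (spaceImageOf S U) < Module.finrank ℂ U

noncomputable def compSpace (p q m n : ℕ) : Submodule ℂ (Matrix (Fin m) (Fin n) ℂ) where
  carrier := {A | ∀ (i : Fin m) (j : Fin n), p ≤ (i : ℕ) → q ≤ (j : ℕ) → A i j = 0}
  add_mem' := by
    intro a b ha hb i j hi hj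
    simp only [Matrix.add_apply, ha i j hi hj, hb i j hi hj, add_zero]
  zero_mem' := by intro i j _ _; rfl
  smul_mem' := by
    intro c a ha i j hi hj
    simp only [Matrix.smul_apply, ha i j hi hj, smul_zero]

noncomputable def spaceIm {m n : ℕ} (S : Submodule ℂ (Matrix (Fin m) (Fin n) ℂ)) :
    Submodule ℂ (Fin m → ℂ) :=
  Submodule.span ℂ {v | ∃ A ∈ S, ∃ u : Fin n → ℂ, v = A.mulVec u}

noncomputable def spaceKer {m n : ℕ} (S : Submodule ℂ (Matrix (Fin m) (Fin n) ℂ)) :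
    Submodule ℂ (Fin n → ℂ) :=
  ⨅ A ∈ S, LinearMap.ker (Matrix.mulVecLin A)

namespace Matrix

open scoped Kronecker

variable {K : Type*} [Field K]

/-- A full rank factorization, together with one-sided inverses of the factors. -/
theorem exists_rank_factorization {m n : Type*} [Fintype m] [Fintype n] (A : Matrix m n K) :
    ∃ (X : Matrix m (Fin A.rank) K) (Y : Matrix (Fin A.rank) n K)
      (L : Matrix (Fin A.rank) m K) (R : Matrix n (Fin A.rank) K),
      A = X * Y ∧ L * X = 1 ∧ Y * R = 1 := by
  classical
  let e : LinearMap.range A.mulVecLin ≃ₗ[K] (Fin A.rank → K) :=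
    LinearEquiv.ofFinrankEq _ _ (by rw [Module.finrank_fin_fun, Matrix.rank])
  let x : (Fin A.rank → K) →ₗ[K] (m → K) :=
    (LinearMap.range A.mulVecLin).subtype ∘ₗ e.symm.toLinearMap
  let y : (n → K) →ₗ[K] (Fin A.rank → K) := e.toLinearMap ∘ₗ A.mulVecLin.rangeRestrict
  obtain ⟨l, hl⟩ := x.exists_leftInverse_of_injective
    (LinearMap.ker_eq_bot.2 (Subtype.val_injective.comp e.symm.injective))
  obtain ⟨r, hr⟩ := y.exists_rightInverse_of_surjective
    (LinearMap.range_eq_top.2 (e.surjective.comp A.mulVecLin.surjective_rangeRestrict))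
  have hxy : x ∘ₗ y = A.toLin' := by
    ext
    simp [x, y]
  refine ⟨x.toMatrix', y.toMatrix', l.toMatrix', r.toMatrix', ?_, ?_, ?_⟩
  · rw [← LinearMap.toMatrix'_comp, hxy, LinearMap.toMatrix'_toLin']
  · rw [← LinearMap.toMatrix'_comp, hl, LinearMap.toMatrix'_id]
  · rw [← LinearMap.toMatrix'_comp, hr, LinearMap.toMatrix'_id]

theorem rank_kronecker {m₁ n₁ m₂ n₂ : Type*} [Fintype m₁] [Fintype n₁] [Fintype m₂] [Fintype n₂]
    (A : Matrix m₁ n₁ K) (B : Matrix m₂ n₂ K) : (A ⊗ₖ B).rank = A.rank * B.rank := by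
  obtain ⟨X, Y, L, R, hA, hL, hR⟩ := A.exists_rank_factorization
  obtain ⟨X', Y', L', R', hB, hL', hR'⟩ := B.exists_rank_factorization
  have hAB : A ⊗ₖ B = (X ⊗ₖ X') * (Y ⊗ₖ Y') := by
    rw [← mul_kronecker_mul, ← hA, ← hB]
  apply le_antisymm
  · rw [hAB]
    refine (rank_mul_le_left _ _).trans ((rank_le_card_width _).trans ?_)
    simp
  · have h1 : (L ⊗ₖ L') * (A ⊗ₖ B) * (R ⊗ₖ R') = 1 := by
      have hLAR : L * A * R = 1 := by
        rw [show L * A * R = (L * X) * (Y * R) by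
          simp only [congrArg (L * ·) hA, Matrix.mul_assoc], hL, hR, Matrix.mul_one]
      have hLBR : L' * B * R' = 1 := by
        rw [show L' * B * R' = (L' * X') * (Y' * R') by
          simp only [congrArg (L' * ·) hB, Matrix.mul_assoc], hL', hR', Matrix.mul_one]
      rw [← mul_kronecker_mul, ← mul_kronecker_mul, hLAR, hLBR, one_kronecker_one]
    calc A.rank * B.rank
      _ = (1 : Matrix (Fin A.rank × Fin B.rank) (Fin A.rank × Fin B.rank) K).rank := by
          rw [rank_one, Fintype.card_prod, Fintype.card_fin, Fintype.card_fin]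
      _ = ((L ⊗ₖ L') * (A ⊗ₖ B) * (R ⊗ₖ R')).rank := by rw [h1]
      _ ≤ (A ⊗ₖ B).rank := (rank_mul_le_left _ _).trans (rank_mul_le_right _ _)

theorem exists_projection {n : Type*} [Fintype n] (V : Submodule K (n → K)) :
    ∃ P : Matrix n n K, (∀ v ∈ V, P *ᵥ v = v) ∧ ∀ v, P *ᵥ v ∈ V := by
  classical
  obtain ⟨g, hg⟩ := V.subtype.exists_leftInverse_of_injective V.ker_subtype
  refine ⟨(V.subtype ∘ₗ g).toMatrix', fun v hv => ?_, fun v => ?_⟩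
  · rw [LinearMap.toMatrix'_mulVec]
    exact congrArg Subtype.val (LinearMap.congr_fun hg ⟨v, hv⟩)
  · rw [LinearMap.toMatrix'_mulVec]
    exact (g v).2

end Matrix

section MaximalRank

open scoped Kronecker

theorem bddAbove_rank_image {m n : Type*} [Fintype m] [Fintype n]
    (S : Submodule ℂ (Matrix m n ℂ)) :
    BddAbove (Matrix.rank '' (S : Set (Matrix m n ℂ))) :=
  ⟨Fintype.card n, by rintro _ ⟨A, -, rfl⟩; exact A.rank_le_card_width⟩

theorem rank_le_mrk {m n : Type*} [Fintype m] [Fintype n] {S : Submodule ℂ (Matrix m n ℂ)}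
    {A : Matrix m n ℂ} (hA : A ∈ S) : A.rank ≤ mrk S :=
  le_csSup (bddAbove_rank_image S) ⟨A, hA, rfl⟩

theorem mrk_le {m n : Type*} [Fintype m] [Fintype n] {S : Submodule ℂ (Matrix m n ℂ)} {r : ℕ}
    (h : ∀ A ∈ S, A.rank ≤ r) : mrk S ≤ r :=
  csSup_le ⟨_, 0, S.zero_mem, rfl⟩ (by rintro _ ⟨A, hA, rfl⟩; exact h A hA)

theorem exists_rank_eq_mrk {m n : Type*} [Fintype m] [Fintype n]
    (S : Submodule ℂ (Matrix m n ℂ)) : ∃ A ∈ S, A.rank = mrk S :=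
  Nat.sSup_mem (Set.Nonempty.image _ ⟨0, S.zero_mem⟩) (bddAbove_rank_image S)

theorem mrk_mul_mrk_le_mrk_tensorSpace {m₁ n₁ m₂ n₂ : Type*}
    [Fintype m₁] [Fintype n₁] [Fintype m₂] [Fintype n₂]
    (S : Submodule ℂ (Matrix m₁ n₁ ℂ)) (T : Submodule ℂ (Matrix m₂ n₂ ℂ)) :
    mrk S * mrk T ≤ mrk (tensorSpace S T) := by
  obtain ⟨A, hA, hAS⟩ := exists_rank_eq_mrk S
  obtain ⟨B, hB, hBT⟩ := exists_rank_eq_mrk T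
  rw [← hAS, ← hBT, ← Matrix.rank_kronecker]
  exact rank_le_mrk (Submodule.subset_span ⟨A, hA, B, hB, rfl⟩)

theorem mrk_tensorSpace_le_of_mul_left {m₁ n₁ m₂ n₂ : Type*}
    [Fintype m₁] [Fintype n₁] [Fintype m₂] [Fintype n₂]
    {S : Submodule ℂ (Matrix m₁ n₁ ℂ)} {T : Submodule ℂ (Matrix m₂ n₂ ℂ)}
    {P : Matrix m₁ m₁ ℂ} {Q : Matrix m₂ m₂ ℂ}
    (hP : ∀ A ∈ S, P * A = A) (hQ : ∀ B ∈ T, Q * B = B) :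
    mrk (tensorSpace S T) ≤ P.rank * Q.rank := by
  have key : ∀ M ∈ tensorSpace S T, (P ⊗ₖ Q) * M = M := by
    intro M hM
    refine Submodule.span_induction ?_ (Matrix.mul_zero _) ?_ ?_ hM
    · rintro _ ⟨A, hA, B, hB, rfl⟩
      rw [← Matrix.mul_kronecker_mul, hP A hA, hQ B hB]
    · intro M N _ _ hM hN
      rw [Matrix.mul_add, hM, hN]
    · intro c M _ hM
      rw [Matrix.mul_smul, hM]
  refine mrk_le fun M hM => ?_
  rw [← key M hM, ← Matrix.rank_kronecker]
  exact Matrix.rank_mul_le_left _ _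

theorem mrk_tensorSpace_le_of_mul_right {m₁ n₁ m₂ n₂ : Type*}
    [Fintype m₁] [Fintype n₁] [Fintype m₂] [Fintype n₂]
    {S : Submodule ℂ (Matrix m₁ n₁ ℂ)} {T : Submodule ℂ (Matrix m₂ n₂ ℂ)}
    {P : Matrix n₁ n₁ ℂ} {Q : Matrix n₂ n₂ ℂ}
    (hP : ∀ A ∈ S, A * P = A) (hQ : ∀ B ∈ T, B * Q = B) :
    mrk (tensorSpace S T) ≤ P.rank * Q.rank := by
  have key : ∀ M ∈ tensorSpace S T, M * (P ⊗ₖ Q) = M := by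
    intro M hM
    refine Submodule.span_induction ?_ (Matrix.zero_mul _) ?_ ?_ hM
    · rintro _ ⟨A, hA, B, hB, rfl⟩
      rw [← Matrix.mul_kronecker_mul, hP A hA, hQ B hB]
    · intro M N _ _ hM hN
      rw [Matrix.add_mul, hM, hN]
    · intro c M _ hM
      rw [Matrix.smul_mul, hM]
  refine mrk_le fun M hM => ?_
  rw [← key M hM, ← Matrix.rank_kronecker]
  exact Matrix.rank_mul_le_right _ _

theorem exists_mul_left_eq_self_rank_le {m n : ℕ} (S : Submodule ℂ (Matrix (Fin m) (Fin n) ℂ)) :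
    ∃ P : Matrix (Fin m) (Fin m) ℂ,
      (∀ A ∈ S, P * A = A) ∧ P.rank ≤ Module.finrank ℂ (spaceIm S) := by
  obtain ⟨P, hP, hPmem⟩ := Matrix.exists_projection (spaceIm S)
  refine ⟨P, fun A hA => Matrix.ext_of_mulVec_single fun j => ?_, Submodule.finrank_mono ?_⟩
  · rw [← Matrix.mulVec_mulVec]
    exact hP _ (Submodule.subset_span ⟨A, hA, _, rfl⟩)
  · rintro _ ⟨v, rfl⟩
    exact hPmem v

theorem exists_mul_right_eq_self_rank_le {m n : ℕ} (S : Submodule ℂ (Matrix (Fin m) (Fin n) ℂ)) :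
    ∃ P : Matrix (Fin n) (Fin n) ℂ,
      (∀ A ∈ S, A * P = A) ∧ P.rank ≤ n - Module.finrank ℂ (spaceKer S) := by
  obtain ⟨P, hP, hPmem⟩ := Matrix.exists_projection (spaceKer S)
  refine ⟨1 - P, fun A hA => Matrix.ext_of_mulVec_single fun j => ?_, ?_⟩
  · have hker : A *ᵥ (P *ᵥ Pi.single j 1) = 0 := by
      have hmem := hPmem (Pi.single j 1)
      simp only [spaceKer, Submodule.mem_iInf] at hmem
      exact hmem A hA
    rw [← Matrix.mulVec_mulVec, Matrix.sub_mulVec, Matrix.mulVec_sub, hker, Matrix.one_mulVec,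
      sub_zero]
  · have hle : spaceKer S ≤ LinearMap.ker (1 - P).mulVecLin := fun v hv => by
      simp [hP v hv]
    have hdim := (1 - P).mulVecLin.finrank_range_add_finrank_ker
    rw [Module.finrank_fin_fun] at hdim
    have := Submodule.finrank_mono hle
    rw [Matrix.rank]
    omega

end MaximalRank

theorem stmt8 {m n : ℕ} (S : Submodule ℂ (Matrix (Fin m) (Fin n) ℂ)) (hS : S ≠ ⊥)
    (h : mrk S = Module.finrank ℂ (spaceIm S) ∨
         mrk S = n - Module.finrank ℂ (spaceKer S)) :
    mrk (tensorSpace S S) = (mrk S) ^ 2 := by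
  apply le_antisymm
  · rcases h with h | h
    · obtain ⟨P, hP, hrank⟩ := exists_mul_left_eq_self_rank_le S
      rw [← h] at hrank
      exact (mrk_tensorSpace_le_of_mul_left hP hP).trans
        ((Nat.mul_le_mul hrank hrank).trans_eq (sq _).symm)
    · obtain ⟨P, hP, hrank⟩ := exists_mul_right_eq_self_rank_le S
      rw [← h] at hrank
      exact (mrk_tensorSpace_le_of_mul_right hP hP).trans
        ((Nat.mul_le_mul hrank hrank).trans_eq (sq _).symm)
  · rw [sq]
    exact mrk_mul_mrk_le_mrk_tensorSpace S S
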